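/- arXiv:math-ph/0409031 — 3 statements merged into one kernel-verified Lean document; each statement's English description precedes it below -/
import Mathlib

section
/- Let p be an odd prime, n a positive integer, and let (π, V) be an irreducible finite-dimensional complex representation of the finite Heisenberg group H with nontrivial central character. Then there exists a group homomorphism ρ : Sp(2n,F_p) → GL(V) satisfying the Egorov identity with respect to π, i.e. ρ(g)π(v,t)ρ(g)^{-1} = π(gv,t) for all g ∈ Sp(2n,F_p) and (v,t) ∈ H. -/
open scoped BigOperators

namespace RK

/-- The standard symplectic form `ω(v,w) = ∑ᵢ (vᵢ w_{n+i} - v_{n+i} wᵢ)`. -/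
def ω {R : Type*} [CommRing R] {n : ℕ} (v w : Fin n ⊕ Fin n → R) : R :=
  ∑ i : Fin n, (v (Sum.inl i) * w (Sum.inr i) - v (Sum.inr i) * w (Sum.inl i))

lemma ω_add_left {R : Type*} [CommRing R] {n : ℕ} (u v w : Fin n ⊕ Fin n → R) :
    ω (u + v) w = ω u w + ω v w := by
  simp only [ω, Pi.add_apply, ← Finset.sum_add_distrib]
  exact Finset.sum_congr rfl fun i _ => by ring

lemma ω_add_right {R : Type*} [CommRing R] {n : ℕ} (u v w : Fin n ⊕ Fin n → R) :
    ω u (v + w) = ω u v + ω u w := by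
  simp only [ω, Pi.add_apply, ← Finset.sum_add_distrib]
  exact Finset.sum_congr rfl fun i _ => by ring

@[simp] lemma ω_zero_left {R : Type*} [CommRing R] {n : ℕ} (w : Fin n ⊕ Fin n → R) :
    ω 0 w = 0 := by simp [ω]

@[simp] lemma ω_zero_right {R : Type*} [CommRing R] {n : ℕ} (v : Fin n ⊕ Fin n → R) :
    ω v 0 = 0 := by simp [ω]

@[simp] lemma ω_neg_left {R : Type*} [CommRing R] {n : ℕ} (v w : Fin n ⊕ Fin n → R) :
    ω (-v) w = - ω v w := by
  simp only [ω, Pi.neg_apply, ← Finset.sum_neg_distrib]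
  exact Finset.sum_congr rfl fun i _ => by ring

@[simp] lemma ω_self {R : Type*} [CommRing R] {n : ℕ} (v : Fin n ⊕ Fin n → R) :
    ω v v = 0 := by simp [ω, mul_comm]

/-- `F_p^{2n}`, with coordinates indexed by `Fin n ⊕ Fin n`. -/
abbrev Vec (p n : ℕ) := Fin n ⊕ Fin n → ZMod p

/-- The finite Heisenberg group `H = F_p^{2n} × F_p`. -/
@[ext]
structure Heis (p n : ℕ) where
  v : Vec p n
  t : ZMod p

/-- `ν = (p+1)/2`, the inverse of `2` mod `p`. -/
def ν (p : ℕ) : ZMod p := ((p + 1) / 2 : ℕ)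

instance {p n : ℕ} : Mul (Heis p n) :=
  ⟨fun a b => ⟨a.v + b.v, a.t + b.t + ν p * ω a.v b.v⟩⟩
instance {p n : ℕ} : One (Heis p n) := ⟨⟨0, 0⟩⟩
instance {p n : ℕ} : Inv (Heis p n) := ⟨fun a => ⟨-a.v, -a.t⟩⟩

lemma Heis.mul_def {p n : ℕ} (a b : Heis p n) :
    a * b = ⟨a.v + b.v, a.t + b.t + ν p * ω a.v b.v⟩ := rfl
lemma Heis.one_def {p n : ℕ} : (1 : Heis p n) = ⟨0, 0⟩ := rfl
lemma Heis.inv_def {p n : ℕ} (a : Heis p n) : a⁻¹ = ⟨-a.v, -a.t⟩ := rfl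

instance {p n : ℕ} : Group (Heis p n) where
  mul := (· * ·)
  one := 1
  inv := Inv.inv
  mul_assoc a b c := by
    simp only [Heis.mul_def, ω_add_left, ω_add_right, Heis.mk.injEq]
    exact ⟨add_assoc _ _ _, by ring⟩
  one_mul a := by simp [Heis.mul_def, Heis.one_def]
  mul_one a := by simp [Heis.mul_def, Heis.one_def]
  inv_mul_cancel a := by simp [Heis.mul_def, Heis.inv_def, Heis.one_def]

/-- The symplectic group `Sp(2n, F_p)`: invertible matrices preserving `ω`. -/
def Sp (p n : ℕ) : Subgroup ((Matrix (Fin n ⊕ Fin n) (Fin n ⊕ Fin n) (ZMod p))ˣ) where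
  carrier := {A | ∀ v w : Vec p n, ω (A.val.mulVec v) (A.val.mulVec w) = ω v w}
  one_mem' := by
    intro v w
    simp [Matrix.one_mulVec]
  mul_mem' := by
    intro A B hA hB v w
    simp only [Units.val_mul, ← Matrix.mulVec_mulVec]
    rw [hA, hB]
  inv_mem' := by
    intro A hA v w
    have h := hA (A⁻¹.val.mulVec v) (A⁻¹.val.mulVec w)
    rw [Matrix.mulVec_mulVec, Matrix.mulVec_mulVec, Units.mul_inv, Matrix.one_mulVec,
      Matrix.one_mulVec] at h
    exact h.symm

/-- The matrix underlying an element of `Sp(2n, F_p)`. -/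
def Sp.mat {p n : ℕ} (A : Sp p n) : Matrix (Fin n ⊕ Fin n) (Fin n ⊕ Fin n) (ZMod p) :=
  (A : (Matrix (Fin n ⊕ Fin n) (Fin n ⊕ Fin n) (ZMod p))ˣ).val

/-- The Egorov identity: `ρ(g) π(v,t) ρ(g)⁻¹ = π(gv, t)`. -/
def Egorov {p n : ℕ} {V : Type*} [AddCommGroup V] [Module ℂ V]
    (π : Representation ℂ (Heis p n) V) (ρ : Sp p n → (Module.End ℂ V)ˣ) : Prop :=
  ∀ (g : Sp p n) (v : Vec p n) (t : ZMod p),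
    (ρ g : Module.End ℂ V) * π ⟨v, t⟩ * ((ρ g)⁻¹ : (Module.End ℂ V)ˣ) =
      π ⟨(Sp.mat g).mulVec v, t⟩

/-- Irreducibility of a representation: `V ≠ 0` and the only invariant subspaces are `⊥` and `⊤`. -/
def IsIrreducibleRep {G : Type*} [Monoid G] {V : Type*} [AddCommGroup V] [Module ℂ V]
    (π : Representation ℂ G V) : Prop :=
  (∃ x : V, x ≠ 0) ∧
    ∀ W : Submodule ℂ V, (∀ (g : G) (x : V), x ∈ W → π g x ∈ W) → W = ⊥ ∨ W = ⊤

noncomputable instance {p n : ℕ} [NeZero p] : Fintype (Sp p n) := Fintype.ofFinite _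

noncomputable instance {p n : ℕ} [NeZero p] (H : Subgroup (Sp p n)) : Fintype H :=
  Fintype.ofFinite _

end RK

namespace RK


lemma linearize_aux {V : Type*} [AddCommGroup V] [Module ℂ V] [FiniteDimensional ℂ V]
    {G : Type*} [Group G] (Vp Vm : Submodule ℂ V)
    (hdim : Module.finrank ℂ Vp = Module.finrank ℂ Vm + 1)
    (T : G → (Module.End ℂ V)ˣ)
    (hTp : ∀ g, ∀ x ∈ Vp, (T g : Module.End ℂ V) x ∈ Vp)
    (hTm : ∀ g, ∀ x ∈ Vm, (T g : Module.End ℂ V) x ∈ Vm)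
    (hT : ∀ g h, ∃ c : ℂ, (T (g * h) : Module.End ℂ V) = c • ((T g : Module.End ℂ V) * T h)) :
    ∃ ρ : G →* (Module.End ℂ V)ˣ, ∀ g, ∃ c : ℂˣ,
      ρ g = Units.map (algebraMap ℂ (Module.End ℂ V)).toMonoidHom c * T g := by
  have hinj : ∀ g, Function.Injective (T g : Module.End ℂ V) := by
    intro g x y hxy
    have := congrArg ((↑(T g)⁻¹ : Module.End ℂ V)) hxy
    rwa [← Module.End.mul_apply, ← Module.End.mul_apply, Units.inv_mul] at this
  have hne : ∀ (W : Submodule ℂ V) (g) (h : ∀ x ∈ W, (T g : Module.End ℂ V) x ∈ W),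
      LinearMap.det (LinearMap.restrict (T g : Module.End ℂ V) h) ≠ 0 := by
    intro W g h h0
    have := LinearMap.bot_lt_ker_of_det_eq_zero h0
    have h2 : LinearMap.ker (LinearMap.restrict (T g : Module.End ℂ V) h) = ⊥ := by
      rw [LinearMap.ker_eq_bot]
      intro x y hxy
      apply Subtype.ext
      apply hinj g
      exact congrArg Subtype.val hxy
    rw [h2] at this
    exact lt_irrefl _ this
  have hmul : ∀ (W : Submodule ℂ V) (h : ∀ g, ∀ x ∈ W, (T g : Module.End ℂ V) x ∈ W) (g g' : G)
      (c : ℂ) (hc : (T (g * g') : Module.End ℂ V) = c • ((T g : Module.End ℂ V) * T g')),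
      LinearMap.det (LinearMap.restrict (T (g * g') : Module.End ℂ V) (h (g * g'))) =
      c ^ Module.finrank ℂ W * (LinearMap.det (LinearMap.restrict (T g : Module.End ℂ V) (h g)) *
       LinearMap.det (LinearMap.restrict (T g' : Module.End ℂ V) (h g'))) := by
    intro W h g g' c hc
    rw [← LinearMap.det_comp, ← LinearMap.det_smul]
    congr 1
    ext x
    simp [hc]
  let a : G → ℂ := fun g => LinearMap.det (LinearMap.restrict (T g : Module.End ℂ V) (hTp g))
  let b : G → ℂ := fun g => LinearMap.det (LinearMap.restrict (T g : Module.End ℂ V) (hTm g))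
  have ha : ∀ g, a g ≠ 0 := fun g => hne _ g _
  have hb : ∀ g, b g ≠ 0 := fun g => hne _ g _
  let c : G → ℂˣ := fun g => Units.mk0 (b g / a g) (div_ne_zero (hb g) (ha g))
  refine ⟨MonoidHom.mk' (fun g => Units.map (algebraMap ℂ (Module.End ℂ V)).toMonoidHom (c g) * T g)
    ?_, fun g => ⟨c g, rfl⟩⟩
  intro g h
  obtain ⟨k, hk⟩ := hT g h
  have h1 : a (g * h) = k ^ Module.finrank ℂ Vp * (a g * a h) := hmul Vp hTp g h k hk
  have h2 : b (g * h) = k ^ Module.finrank ℂ Vm * (b g * b h) := hmul Vm hTm g h k hk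
  have hk0 : k ≠ 0 := by
    rintro rfl
    apply ha (g * h)
    rw [h1, hdim]; simp
  have h3 : b (g * h) / a (g * h) * k = (b g / a g) * (b h / a h) := by
    rw [h1, h2, hdim, pow_succ]
    have := ha g
    have := ha h
    field_simp
  apply Units.ext
  simp only [Units.val_mul, Units.coe_map, c, Units.val_mk0, hk, RingHom.toMonoidHom_eq_coe,
    MonoidHom.coe_coe, Algebra.algebraMap_eq_smul_one, smul_mul_assoc, one_mul, mul_smul_comm, smul_smul]
  rw [mul_comm k, h3, mul_comm (b g / a g)]

section
variable {p n : ℕ} [Fact p.Prime] {V : Type*} [AddCommGroup V] [Module ℂ V]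

lemma two_ν (hp : p ≠ 2) : 2 * ν p = 1 := by
  have hodd := (Fact.out : p.Prime).odd_of_ne_two hp
  obtain ⟨k, hk⟩ := hodd
  have : (p + 1) / 2 = k + 1 := by omega
  rw [ν, this]
  have h : ((2 * k + 1 : ℕ) : ZMod p) = 0 := by rw [← hk]; simp
  push_cast at h ⊢
  linear_combination h

lemma ω_neg_right {R : Type*} [CommRing R] {n : ℕ} (v w : Fin n ⊕ Fin n → R) :
    ω v (-w) = - ω v w := by
  have := ω_add_right v w (-w)
  simp at this
  linear_combination -this

lemma ω_swap {R : Type*} [CommRing R] {n : ℕ} (v w : Fin n ⊕ Fin n → R) :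
    ω w v = - ω v w := by
  have := ω_self (v + w)
  rw [ω_add_right, ω_add_left, ω_add_left] at this
  simp at this
  linear_combination this

lemma exists_ω {v : Vec p n} (hv : v ≠ 0) (s : ZMod p) : ∃ w : Vec p n, ω w v = s := by
  obtain ⟨i, hi⟩ := Function.ne_iff.mp hv
  simp only [Pi.zero_apply] at hi
  rcases i with i | i
  · refine ⟨Pi.single (Sum.inr i) (-s / v (Sum.inl i)), ?_⟩
    simp only [ω]
    rw [Finset.sum_eq_single i]
    · simp; field_simp
    · intro j _ hj; simp [hj]
    · simp
  · refine ⟨Pi.single (Sum.inl i) (s / v (Sum.inr i)), ?_⟩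
    simp only [ω]
    rw [Finset.sum_eq_single i]
    · simp; field_simp
    · intro j _ hj; simp [hj]
    · simp

/-- hypotheses bundle -/
structure Good (π : Representation ℂ (Heis p n) V) (ψ : ZMod p → ℂ) : Prop where
  hp : p ≠ 2
  irr : IsIrreducibleRep π
  cen : ∀ s : ZMod p, π ⟨0, s⟩ = ψ s • (1 : Module.End ℂ V)
  nt : ∃ s, ψ s ≠ 1

variable {π : Representation ℂ (Heis p n) V} {ψ : ZMod p → ℂ}

lemma Good.pi_eq (G : Good π ψ) (v : Vec p n) (t : ZMod p) : π ⟨v, t⟩ = ψ t • π ⟨v, 0⟩ := by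
  have : (⟨v, t⟩ : Heis p n) = ⟨0, t⟩ * ⟨v, 0⟩ := by simp [Heis.mul_def]
  rw [this, map_mul, G.cen, smul_mul_assoc, one_mul]

lemma pi_zero (π : Representation ℂ (Heis p n) V) : π ⟨0, 0⟩ = 1 := map_one π

lemma Good.mul (G : Good π ψ) (v w : Vec p n) :
    π ⟨v, 0⟩ * π ⟨w, 0⟩ = ψ (ν p * ω v w) • π ⟨v + w, 0⟩ := by
  rw [← map_mul, Heis.mul_def, ← G.pi_eq]; simp

lemma pi_neg (π : Representation ℂ (Heis p n) V) (v : Vec p n) :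
    π ⟨v, 0⟩ * π ⟨-v, 0⟩ = 1 := by
  rw [← map_mul, Heis.mul_def]
  simp [ω_neg_right, pi_zero]

lemma pi_neg' (π : Representation ℂ (Heis p n) V) (v : Vec p n) :
    π ⟨-v, 0⟩ * π ⟨v, 0⟩ = 1 := by
  simpa using pi_neg π (-v)

lemma Good.conj (G : Good π ψ) (v w : Vec p n) :
    π ⟨w, 0⟩ * π ⟨v, 0⟩ * π ⟨-w, 0⟩ = ψ (ω w v) • π ⟨v, 0⟩ := by
  rw [← map_mul, ← map_mul, Heis.mul_def, Heis.mul_def, ← G.pi_eq]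
  congr 2
  · simp
  · simp only [ω_add_left, ω_neg_right, ω_self]
    rw [ω_swap w v]
    linear_combination (ω w v) * two_ν G.hp

lemma Good.sandwich (v w : Vec p n) :
    π ⟨w, 0⟩ * π ⟨v, 0⟩ * π ⟨w, 0⟩ = π ⟨v + (w + w), 0⟩ := by
  rw [← map_mul, ← map_mul, Heis.mul_def, Heis.mul_def]
  congr 2
  · simp only; abel
  · simp only [ω_add_left, ω_self]
    rw [ω_swap w v]
    ring

lemma Good.trace_zero (G : Good π ψ) {v : Vec p n} (hv : v ≠ 0) :
    LinearMap.trace ℂ V (π ⟨v, 0⟩) = 0 := by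
  obtain ⟨s, hs⟩ := G.nt
  obtain ⟨w, hw⟩ := exists_ω hv s
  have h := congrArg (LinearMap.trace ℂ V) (G.conj v w)
  rw [LinearMap.trace_mul_comm, ← mul_assoc, pi_neg', one_mul, hw, map_smul, smul_eq_mul] at h
  have : (ψ s - 1) * LinearMap.trace ℂ V (π ⟨v, 0⟩) = 0 := by linear_combination -h
  exact (mul_eq_zero.mp this).resolve_left (sub_ne_zero.mpr hs)

variable [FiniteDimensional ℂ V]

lemma Good.d_ne (G : Good π ψ) : (Module.finrank ℂ V : ℂ) ≠ 0 := by
  obtain ⟨x, hx⟩ := G.irr.1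
  have : Nontrivial V := ⟨x, 0, hx⟩
  exact_mod_cast Module.finrank_pos.ne'

lemma Good.trace_mul (G : Good π ψ) (v w : Vec p n) :
    LinearMap.trace ℂ V (π ⟨v, 0⟩ * π ⟨w, 0⟩) =
      if w = -v then (Module.finrank ℂ V : ℂ) else 0 := by
  split_ifs with h
  · rw [h, pi_neg, LinearMap.trace_one]
  · rw [G.mul, map_smul, G.trace_zero, smul_zero]
    intro h2
    exact h (eq_neg_of_add_eq_zero_right h2)

lemma Good.schur (G : Good π ψ) (A : Module.End ℂ V)
    (hA : ∀ v, A * π ⟨v, 0⟩ = π ⟨v, 0⟩ * A) : ∃ c : ℂ, A = c • 1 := by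
  obtain ⟨x, hx⟩ := G.irr.1
  have : Nontrivial V := ⟨x, 0, hx⟩
  obtain ⟨c, hc⟩ := Module.End.exists_eigenvalue A
  refine ⟨c, ?_⟩
  have hinv := G.irr.2 (Module.End.eigenspace A c) (by
    rintro ⟨v, t⟩ y hy
    rw [Module.End.mem_eigenspace_iff] at hy ⊢
    rw [G.pi_eq]
    have := congrArg (fun f : Module.End ℂ V => f y) (hA v)
    simp only [Module.End.mul_apply, hy, map_smul] at this
    simp only [LinearMap.smul_apply, map_smul, this]
    rw [smul_comm])
  rcases hinv with h | h
  · exact absurd h hc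
  · ext y
    have : y ∈ Module.End.eigenspace A c := by rw [h]; trivial
    simpa using Module.End.mem_eigenspace_iff.mp this

/-- additive bijection preserving ω -/
lemma Good.exists_T (G : Good π ψ) (g : Vec p n →+ Vec p n) (hg : Function.Injective g)
    (hω : ∀ v w, ω (g v) (g w) = ω v w) :
    ∃ T : (Module.End ℂ V)ˣ, ∀ v, (T : Module.End ℂ V) * π ⟨v, 0⟩ = π ⟨g v, 0⟩ * T := by
  let F : Module.End ℂ V → Module.End ℂ V := fun A => ∑ v : Vec p n, π ⟨g v, 0⟩ * A * π ⟨-v, 0⟩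
  have hF : ∀ A w, F A * π ⟨w, 0⟩ = π ⟨g w, 0⟩ * F A := by
    intro A w
    simp only [F, Finset.sum_mul, Finset.mul_sum]
    rw [← Equiv.sum_comp (Equiv.addLeft w)]
    refine Finset.sum_congr rfl fun v _ => ?_
    simp only [Equiv.coe_addLeft, map_add]
    have e1 : π ⟨-(w + v), 0⟩ * π ⟨w, 0⟩ = ψ (- (ν p * ω v w)) • π ⟨-v, 0⟩ := by
      rw [G.mul]; congr 2
      · simp [ω_add_left]
      · congr 1; abel
    have e2 : π ⟨g w, 0⟩ * π ⟨g v, 0⟩ = ψ (- (ν p * ω v w)) • π ⟨g w + g v, 0⟩ := by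
      rw [G.mul, hω, ω_swap v w, mul_neg]
    rw [mul_assoc, e1, ← mul_assoc, ← mul_assoc, e2]
    simp only [mul_smul_comm, smul_mul_assoc]
  have hex : ∃ A, F A ≠ 0 := by
    by_contra hcon
    push Not at hcon
    obtain ⟨x, hx⟩ := G.irr.1
    have hφ' : ∃ φ : Module.Dual ℂ V, φ x ≠ 0 := by
      by_contra h
      push Not at h
      exact hx ((Module.forall_dual_apply_eq_zero_iff ℂ x).mp h)
    obtain ⟨φ, hφ⟩ := hφ'
    have h1 : ∑ v : Vec p n, φ (π ⟨-v, 0⟩ x) • π ⟨g v, 0⟩ = 0 := by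
      ext y
      have := congrArg (fun f : Module.End ℂ V => f x) (hcon (LinearMap.smulRight φ y))
      simpa [F, LinearMap.sum_apply] using this
    have h2 := congrArg (LinearMap.trace ℂ V) h1
    rw [map_sum, Finset.sum_eq_single 0] at h2
    · simp only [map_smul, map_zero, pi_zero, neg_zero, LinearMap.trace_one] at h2
      exact mul_ne_zero hφ G.d_ne (by simpa using h2)
    · intro v _ hv
      rw [map_smul, G.trace_zero, smul_zero]
      intro h
      exact hv (hg (by simpa using h))
    · simp
  obtain ⟨A, hA⟩ := hex
  have hker : LinearMap.ker (F A) = ⊥ := by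
    refine (G.irr.2 (LinearMap.ker (F A)) ?_).resolve_right ?_
    · rintro ⟨v, t⟩ y hy
      rw [LinearMap.mem_ker] at hy ⊢
      have := congrArg (fun f : Module.End ℂ V => f y) (hF A v)
      simp only [Module.End.mul_apply, hy, map_zero] at this
      rw [G.pi_eq, LinearMap.smul_apply, map_smul, this, smul_zero]
    · intro h
      exact hA (LinearMap.ker_eq_top.mp h)
  obtain ⟨T, hT⟩ := (LinearMap.isUnit_iff_ker_eq_bot (F A)).mpr hker
  exact ⟨T, fun v => by rw [hT]; exact hF A v⟩

lemma Good.dim_sq (G : Good π ψ) :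
    (Module.finrank ℂ V : ℂ) * Module.finrank ℂ V = Fintype.card (Vec p n) := by
  set d : ℂ := (Module.finrank ℂ V : ℂ) with hd
  have key : ∀ A : Module.End ℂ V, d • ∑ v : Vec p n, π ⟨v, 0⟩ * A * π ⟨-v, 0⟩ =
      ((Fintype.card (Vec p n) : ℂ) * LinearMap.trace ℂ V A) • 1 := by
    intro A
    obtain ⟨c, hc⟩ := G.schur (∑ v : Vec p n, π ⟨v, 0⟩ * A * π ⟨-v, 0⟩) (by
      intro w
      simp only [Finset.sum_mul, Finset.mul_sum]
      rw [← Equiv.sum_comp (Equiv.addLeft w)]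
      refine Finset.sum_congr rfl fun v _ => ?_
      simp only [Equiv.coe_addLeft]
      have e1 : π ⟨-(w + v), 0⟩ * π ⟨w, 0⟩ = ψ (- (ν p * ω v w)) • π ⟨-v, 0⟩ := by
        rw [G.mul]; congr 2
        · simp [ω_add_left]
        · congr 1; abel
      have e2 : π ⟨w, 0⟩ * π ⟨v, 0⟩ = ψ (- (ν p * ω v w)) • π ⟨w + v, 0⟩ := by
        rw [G.mul, ω_swap v w, mul_neg]
      rw [mul_assoc, e1, ← mul_assoc, ← mul_assoc, e2]
      simp only [mul_smul_comm, smul_mul_assoc])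
    have h2 := congrArg (LinearMap.trace ℂ V) hc
    rw [map_sum, map_smul, LinearMap.trace_one] at h2
    have h3 : ∀ v : Vec p n, LinearMap.trace ℂ V (π ⟨v, 0⟩ * A * π ⟨-v, 0⟩) =
        LinearMap.trace ℂ V A := by
      intro v
      rw [LinearMap.trace_mul_comm, ← mul_assoc, pi_neg', one_mul]
    simp only [h3, Finset.sum_const, Finset.card_univ, nsmul_eq_mul, smul_eq_mul] at h2
    rw [hc, smul_smul, h2, hd, mul_comm]
  obtain ⟨x, hx⟩ := G.irr.1
  let b := Module.finBasis ℂ V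
  have tr : ∀ f : Module.End ℂ V, LinearMap.trace ℂ V f = ∑ i, b.coord i (f (b i)) := by
    intro f
    rw [LinearMap.trace_eq_matrix_trace ℂ b]
    simp [Matrix.trace, LinearMap.toMatrix_apply]
  have h1 : ∀ i, d • ∑ v : Vec p n, b.coord i (π ⟨-v, 0⟩ (b i)) • π ⟨v, 0⟩ x =
      (Fintype.card (Vec p n) : ℂ) • (b.coord i x • b i) := by
    intro i
    have := congrArg (fun f : Module.End ℂ V => f (b i)) (key (LinearMap.smulRight (b.coord i) x))
    have ht : LinearMap.trace ℂ V (LinearMap.smulRight (b.coord i) x) = b.coord i x := by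
      simp
    rw [ht] at this
    simpa [LinearMap.sum_apply, smul_smul] using this
  have h2 := Finset.sum_congr (rfl : (Finset.univ : Finset (Fin _)) = Finset.univ) (fun i _ => h1 i)
  rw [← Finset.smul_sum, ← Finset.smul_sum, Finset.sum_comm] at h2
  simp only [← Finset.sum_smul, ← tr] at h2
  rw [Finset.sum_eq_single 0] at h2
  · have h3 : ∑ i, b.coord i x • b i = x := b.sum_repr x
    rw [h3, neg_zero, pi_zero, LinearMap.trace_one, smul_smul, Module.End.one_apply] at h2
    exact smul_left_injective ℂ hx h2
  · intro v _ hv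
    rw [G.trace_zero (neg_ne_zero.mpr hv), zero_smul]
  · simp

lemma Good.exists_P (G : Good π ψ) : ∃ P : Module.End ℂ V, P * P = 1 ∧
    LinearMap.trace ℂ V P = 1 ∧
    ∀ (g : Vec p n →+ Vec p n) (_ : Function.Injective g) (T : Module.End ℂ V)
      (_ : ∀ v, T * π ⟨v, 0⟩ = π ⟨g v, 0⟩ * T), T * P = P * T := by
  set S : Module.End ℂ V := ∑ v : Vec p n, π ⟨v, 0⟩ with hS
  set d : ℂ := (Module.finrank ℂ V : ℂ) with hd
  have hd0 : d ≠ 0 := G.d_ne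
  have hsand : ∀ w : Vec p n, π ⟨w, 0⟩ * S * π ⟨w, 0⟩ = S := by
    intro w
    simp only [hS, Finset.sum_mul, Finset.mul_sum, Good.sandwich]
    exact Equiv.sum_comp (Equiv.addRight (w + w)) (fun v => π ⟨v, 0⟩)
  have hSw : ∀ w : Vec p n, S * π ⟨w, 0⟩ = π ⟨-w, 0⟩ * S := by
    intro w
    conv_rhs => rw [← hsand w]
    rw [← mul_assoc, ← mul_assoc, pi_neg', one_mul]
  have hSS : S * S = (d * d) • 1 := by
    obtain ⟨c, hc⟩ := G.schur (S * S) (by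
      intro w
      rw [mul_assoc, hSw, ← mul_assoc, hSw, neg_neg, mul_assoc])
    have h1 : LinearMap.trace ℂ V (S * S) = d * d * d := by
      rw [G.dim_sq]
      simp only [hS, Finset.sum_mul, Finset.mul_sum, map_sum, G.trace_mul]
      rw [Finset.sum_comm]
      simp [hd]
    rw [hc, map_smul, LinearMap.trace_one, smul_eq_mul] at h1
    rw [hc, mul_right_cancel₀ hd0 h1]
  have htr : LinearMap.trace ℂ V S = d := by
    rw [hS, map_sum, Finset.sum_eq_single 0]
    · rw [pi_zero, LinearMap.trace_one]
    · intro v _ hv; exact G.trace_zero hv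
    · simp
  refine ⟨d⁻¹ • S, ?_, ?_, ?_⟩
  · rw [smul_mul_smul_comm, hSS, smul_smul]
    have : d⁻¹ * d⁻¹ * (d * d) = 1 := by field_simp
    rw [this, one_smul]
  · rw [map_smul, htr, smul_eq_mul, inv_mul_cancel₀ hd0]
  · intro g hg T hT
    rw [mul_smul_comm, smul_mul_assoc]
    congr 1
    simp only [hS, Finset.sum_mul, Finset.mul_sum, hT]
    exact Equiv.sum_comp (Equiv.ofBijective g (Finite.injective_iff_bijective.mp hg))
      (fun v => π ⟨v, 0⟩ * T)

lemma split_dim (P : Module.End ℂ V) (hP : P * P = 1) (ht : LinearMap.trace ℂ V P = 1) :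
    Module.finrank ℂ (LinearMap.ker (P - 1)) = Module.finrank ℂ (LinearMap.ker (P + 1)) + 1 := by
  have hPP : ∀ x, P (P x) = x := fun x => congrArg (fun f : Module.End ℂ V => f x) hP
  have h1 : LinearMap.IsProj (LinearMap.ker (P - 1)) ((2⁻¹ : ℂ) • (1 + P)) := by
    constructor
    · intro x
      simp [hPP, add_comm]
    · intro x hx
      have : P x = x := by simpa [sub_eq_zero] using hx
      simp only [LinearMap.smul_apply, LinearMap.add_apply, Module.End.one_apply, this]
      rw [← two_smul ℂ x, smul_smul]; norm_num
  have h2 : LinearMap.IsProj (LinearMap.ker (P + 1)) ((2⁻¹ : ℂ) • (1 - P)) := by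
    constructor
    · intro x
      simp [hPP]
    · intro x hx
      have : P x = -x := by simpa [add_eq_zero_iff_eq_neg] using hx
      simp [this, ← two_smul ℂ x]
  have e1 := h1.trace
  have e2 := h2.trace
  rw [map_smul, map_add, ht, LinearMap.trace_one] at e1
  rw [map_smul, map_sub, ht, LinearMap.trace_one] at e2
  simp only [smul_eq_mul] at e1 e2
  have : (Module.finrank ℂ (LinearMap.ker (P - 1)) : ℂ) =
      (Module.finrank ℂ (LinearMap.ker (P + 1)) : ℂ) + 1 := by
    rw [← e1, ← e2]; ring
  exact_mod_cast this

end

/-- canonical linearization — existence of a genuine representation of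
`Sp(2n, F_p)` satisfying the Egorov identity. -/
theorem exists_linearization {p n : ℕ} [Fact p.Prime] (hp : p ≠ 2) (hn : 0 < n)
    {V : Type*} [AddCommGroup V] [Module ℂ V] [FiniteDimensional ℂ V]
    (π : Representation ℂ (Heis p n) V) (hπ : IsIrreducibleRep π)
    (ψ : ZMod p → ℂ) (hψ : ∀ s : ZMod p, π ⟨0, s⟩ = ψ s • (1 : Module.End ℂ V))
    (hψnt : ∃ s, ψ s ≠ 1) :
    ∃ ρ : Sp p n →* (Module.End ℂ V)ˣ, Egorov π ⇑ρ := by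
  have G : Good π ψ := ⟨hp, hπ, hψ, hψnt⟩
  let act : Sp p n → (Vec p n →+ Vec p n) := fun g => (Matrix.mulVecLin (Sp.mat g)).toAddMonoidHom
  have act_apply : ∀ g v, act g v = (Sp.mat g).mulVec v := fun g v => rfl
  have act_mul : ∀ g h v, act (g * h) v = act g (act h v) := by
    intro g h v
    simp [act_apply, Sp.mat, Matrix.mulVec_mulVec]
  have act_one : ∀ v, act 1 v = v := by
    intro v
    simp [act_apply, Sp.mat]
  have act_inj : ∀ g, Function.Injective (act g) := by
    intro g x y hxy
    have := congrArg (act g⁻¹) hxy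
    rwa [← act_mul, ← act_mul, inv_mul_cancel, act_one, act_one] at this
  have act_ω : ∀ g v w, ω (act g v) (act g w) = ω v w := fun g v w => g.2 v w
  choose T hT using fun g => G.exists_T (act g) (act_inj g) (act_ω g)
  obtain ⟨P, hP, htP, hcomm⟩ := G.exists_P
  have hTP : ∀ g, (T g : Module.End ℂ V) * P = P * T g := fun g => hcomm _ (act_inj g) _ (hT g)
  have hTPx : ∀ g x, P ((T g : Module.End ℂ V) x) = (T g : Module.End ℂ V) (P x) := fun g x =>
    (congrArg (fun f : Module.End ℂ V => f x) (hTP g)).symm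
  obtain ⟨ρ, hρ⟩ := linearize_aux (LinearMap.ker (P - 1)) (LinearMap.ker (P + 1))
    (split_dim P hP htP) T
    (by
      intro g x hx
      have : P x = x := by simpa [sub_eq_zero] using hx
      simp [hTPx, this])
    (by
      intro g x hx
      have : P x = -x := by simpa [add_eq_zero_iff_eq_neg] using hx
      simp [hTPx, this])
    (by
      intro g h
      obtain ⟨c, hc⟩ := G.schur ((↑(T g * T h)⁻¹ : Module.End ℂ V) * T (g * h)) (by
        intro v
        rw [mul_assoc, hT, Units.inv_mul_eq_iff_eq_mul]
        have : (↑(T g * T h) : Module.End ℂ V) * π ⟨v, 0⟩ =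
            π ⟨act (g * h) v, 0⟩ * ↑(T g * T h) := by
          rw [Units.val_mul, mul_assoc, hT, ← mul_assoc, hT, act_mul, mul_assoc]
        rw [← mul_assoc, ← mul_assoc, this, mul_assoc _ (↑(T g * T h) : Module.End ℂ V),
          Units.mul_inv, mul_one])
      refine ⟨c, ?_⟩
      rw [Units.inv_mul_eq_iff_eq_mul] at hc
      rw [hc, mul_smul_comm, mul_one, Units.val_mul])
  refine ⟨ρ, ?_⟩
  intro g v t
  rw [Units.mul_inv_eq_iff_eq_mul]
  obtain ⟨c, hc⟩ := hρ g
  rw [hc, G.pi_eq v t, G.pi_eq _ t, ← act_apply]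
  simp only [Units.val_mul, Units.coe_map, RingHom.toMonoidHom_eq_coe,
    MonoidHom.coe_coe, Algebra.algebraMap_eq_smul_one, smul_mul_assoc, one_mul, mul_smul_comm, hT]
  rw [smul_comm]

end RK
end

section
/- Let p be an odd prime, n a positive integer, and let (π, V) be an irreducible finite-dimensional complex representation of the finite Heisenberg group H with nontrivial central character. Then for every g ∈ Sp(2n,F_p), the representation π^g of H on V defined by π^g(v,t) = π(gv,t) is isomorphic to π; that is, the equivalence class of π is fixed by the action of Sp(2n,F_p). -/
open scoped BigOperators

namespace RK

lemma two_mul_ν {p : ℕ} [Fact p.Prime] (hp : p ≠ 2) : 2 * ν p = 1 := by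
  have hodd : p % 2 = 1 := (Fact.out : p.Prime).eq_two_or_odd.resolve_left hp
  have h : 2 * ((p + 1) / 2) = p + 1 := by omega
  have h2 := congrArg (Nat.cast : ℕ → ZMod p) h
  push_cast at h2
  simpa [ν] using h2

/-- Nondegeneracy of `ω`. -/
lemma exists_ω_eq {p n : ℕ} [Fact p.Prime] (v : Vec p n) (hv : v ≠ 0) (s : ZMod p) :
    ∃ w : Vec p n, ω w v = s := by
  obtain ⟨j, hj⟩ := Function.ne_iff.mp hv
  rcases j with i | i
  · refine ⟨Pi.single (Sum.inr i) (-(s / v (Sum.inl i))), ?_⟩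
    have hj' : v (Sum.inl i) ≠ 0 := hj
    simp [ω, Pi.single_apply, hj']
  · refine ⟨Pi.single (Sum.inl i) (s / v (Sum.inr i)), ?_⟩
    have hj' : v (Sum.inr i) ≠ 0 := hj
    simp [ω, Pi.single_apply, hj']

lemma ω_comm {R : Type*} [CommRing R] {n : ℕ} (v w : Fin n ⊕ Fin n → R) :
    ω v w = - ω w v := by
  simp only [ω, ← Finset.sum_neg_distrib]
  exact Finset.sum_congr rfl fun i _ => by ring

/-- The character vanishes off the centre. -/
lemma character_eq_zero {p n : ℕ} [Fact p.Prime] (hp : p ≠ 2)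
    {V : Type*} [AddCommGroup V] [Module ℂ V] [FiniteDimensional ℂ V]
    (π : Representation ℂ (Heis p n) V)
    (ψ : ZMod p → ℂ) (hψ : ∀ s : ZMod p, π ⟨0, s⟩ = ψ s • (1 : Module.End ℂ V))
    (hψnt : ∃ s, ψ s ≠ 1) (v : Vec p n) (hv : v ≠ 0) (t : ZMod p) :
    π.character ⟨v, t⟩ = 0 := by
  obtain ⟨s, hs⟩ := hψnt
  obtain ⟨w, hw⟩ := exists_ω_eq v hv s
  have hconj : (⟨w, 0⟩ : Heis p n) * ⟨v, t⟩ * (⟨w, 0⟩ : Heis p n)⁻¹ = ⟨0, s⟩ * ⟨v, t⟩ := by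
    have hneg : ω v (-w) = s := by rw [ω_comm, ω_neg_left, hw, neg_neg]
    have hneg' : ω w (-w) = 0 := by rw [ω_comm, ω_neg_left]; simp
    simp only [Heis.mul_def, Heis.inv_def, ω_add_left, hneg, hneg', hw, Heis.mk.injEq,
      ω_zero_left]
    refine ⟨by abel, ?_⟩
    linear_combination s * two_mul_ν hp
  have h := π.char_conj ⟨v, t⟩ ⟨w, 0⟩
  rw [hconj] at h
  simp only [Representation.character, map_mul, hψ, smul_mul_assoc, one_mul, map_smul,
    smul_eq_mul] at h
  have h2 : (ψ s - 1) * π.character ⟨v, t⟩ = 0 := by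
    rw [Representation.character]
    linear_combination h
  exact (mul_eq_zero.mp h2).resolve_left (sub_ne_zero.mpr hs)

/-- The automorphism of `H` induced by `g` (as a monoid homomorphism). -/
def actHom {p n : ℕ} (g : Sp p n) : Heis p n →* Heis p n where
  toFun a := ⟨(Sp.mat g).mulVec a.v, a.t⟩
  map_one' := by simp [Heis.one_def]
  map_mul' a b := by
    have h : ω ((Sp.mat g).mulVec a.v) ((Sp.mat g).mulVec b.v) = ω a.v b.v := g.2 a.v b.v
    simp [Heis.mul_def, Matrix.mulVec_add, h]

lemma mat_inv_mulVec {p n : ℕ} (g : Sp p n) (v : Vec p n) :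
    (Sp.mat g).mulVec ((Sp.mat g⁻¹).mulVec v) = v := by
  rw [Matrix.mulVec_mulVec]
  have h : Sp.mat g * Sp.mat g⁻¹ = 1 :=
    Units.mul_inv (g : (Matrix (Fin n ⊕ Fin n) (Fin n ⊕ Fin n) (ZMod p))ˣ)
  rw [h, Matrix.one_mulVec]

lemma actHom_surjective {p n : ℕ} (g : Sp p n) : Function.Surjective (actHom g) := fun a =>
  ⟨⟨(Sp.mat g⁻¹).mulVec a.v, a.t⟩, by
    ext1
    · exact mat_inv_mulVec g a.v
    · rfl⟩

lemma mat_mulVec_ne_zero {p n : ℕ} (g : Sp p n) {v : Vec p n} (hv : v ≠ 0) :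
    (Sp.mat g).mulVec v ≠ 0 := by
  intro h
  apply hv
  have h2 := mat_inv_mulVec g⁻¹ v
  rw [inv_inv, h, Matrix.mulVec_zero] at h2
  exact h2.symm

lemma IsIrreducibleRep.isIrreducible {G : Type*} [Monoid G] {V : Type*} [AddCommGroup V]
    [Module ℂ V] {π : Representation ℂ G V} (h : IsIrreducibleRep π) : π.IsIrreducible where
  exists_pair_ne := by
    obtain ⟨x, hx⟩ := h.1
    refine ⟨⊥, ⊤, fun e => hx ?_⟩
    have e' : (⊥ : Submodule ℂ V) = ⊤ := congrArg Subrepresentation.toSubmodule e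
    have hm : x ∈ (⊥ : Submodule ℂ V) := e' ▸ Submodule.mem_top
    simpa using hm
  eq_bot_or_eq_top W := by
    rcases h.2 W.toSubmodule (fun g x hx => W.apply_mem_toSubmodule g hx) with h | h
    · exact Or.inl (Subrepresentation.toSubmodule_injective h)
    · exact Or.inr (Subrepresentation.toSubmodule_injective h)

/-- the equivalence class of `π` is fixed by `Sp(2n, F_p)`:
`π^g ≃ π` for every `g`. -/
theorem conjugate_representation_isomorphic {p n : ℕ} [Fact p.Prime] (hp : p ≠ 2) (hn : 0 < n)
    {V : Type*} [AddCommGroup V] [Module ℂ V] [FiniteDimensional ℂ V]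
    (π : Representation ℂ (Heis p n) V) (hπ : IsIrreducibleRep π)
    (ψ : ZMod p → ℂ) (hψ : ∀ s : ZMod p, π ⟨0, s⟩ = ψ s • (1 : Module.End ℂ V))
    (hψnt : ∃ s, ψ s ≠ 1) (g : Sp p n) :
    ∃ T : V ≃ₗ[ℂ] V, ∀ (v : Vec p n) (t : ZMod p) (x : V),
      T (π ⟨v, t⟩ x) = π ⟨(Sp.mat g).mulVec v, t⟩ (T x) := by
  classical
  let σ : Representation ℂ (Heis p n) V := π.comp (actHom g)
  have hσapp : ∀ a, σ a = π (actHom g a) := fun _ => rfl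
  have hσ : IsIrreducibleRep σ := by
    refine ⟨hπ.1, fun W hW => hπ.2 W fun a x hx => ?_⟩
    obtain ⟨b, rfl⟩ := actHom_surjective g a
    exact hW b x hx
  have hchar : σ.character = π.character := by
    ext ⟨v, t⟩
    change π.character ⟨(Sp.mat g).mulVec v, t⟩ = _
    by_cases hv : v = 0
    · subst hv
      rw [Matrix.mulVec_zero]
    · rw [character_eq_zero hp π ψ hψ hψnt v hv,
        character_eq_zero hp π ψ hψ hψnt _ (mat_mulVec_ne_zero g hv)]
  have := hπ.isIrreducible
  have := hσ.isIrreducible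
  have : Finite (Heis p n) :=
    Finite.of_injective (fun a : Heis p n => (a.v, a.t)) (by
      rintro ⟨v, t⟩ ⟨w, s⟩ h
      simpa using h)
  letI : Fintype (Heis p n) := Fintype.ofFinite _
  letI : Invertible (Nat.card (Heis p n) : ℂ) :=
    invertibleOfNonzero (Nat.cast_ne_zero.mpr Nat.card_pos.ne')
  have h1 := Representation.char_orthonormal π π
  have h2 := Representation.char_orthonormal σ π
  rw [hchar, h1, if_pos ⟨Representation.Equiv.refl π⟩] at h2
  have hne : Nonempty (π.Equiv σ) := by
    by_contra hcon
    rw [if_neg hcon] at h2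
    exact one_ne_zero h2
  obtain ⟨φ⟩ := hne
  refine ⟨φ.toLinearEquiv, fun v t x => ?_⟩
  exact LinearMap.congr_fun (φ.toIntertwiningMap.isIntertwining' ⟨v, t⟩) x

end RK
end

section
/- Let p be an odd prime, n a positive integer, and let (π, V) be an irreducible finite-dimensional complex representation of the finite Heisenberg group H with nontrivial central character. Then there exists a map ρ : Sp(2n,F_p) → GL(V) satisfying the Egorov identity with respect to π and which is a projective representation: for all g₁, g₂ ∈ Sp(2n,F_p) there exists a scalar c(g₁,g₂) ∈ ℂ^× such that ρ(g₁g₂) = c(g₁,g₂)·ρ(g₁)ρ(g₂). -/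
open scoped BigOperators

namespace RK

/-- The action of a symplectic matrix on the Heisenberg group. -/
def act {p n : ℕ} (g : Sp p n) : Heis p n →* Heis p n where
  toFun h := ⟨(Sp.mat g).mulVec h.v, h.t⟩
  map_one' := by simp [Heis.one_def]
  map_mul' a b := by
    have hg : ω ((Sp.mat g).mulVec a.v) ((Sp.mat g).mulVec b.v) = ω a.v b.v := g.2 a.v b.v
    simp [Heis.mul_def, Matrix.mulVec_add, hg]

lemma act_mul {p n : ℕ} (g₁ g₂ : Sp p n) (h : Heis p n) :
    act (g₁ * g₂) h = act g₁ (act g₂ h) := by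
  simp [act, Sp.mat, Matrix.mulVec_mulVec]

instance {p n : ℕ} [NeZero p] : Finite (Heis p n) :=
  Finite.of_injective (fun h : Heis p n => (h.v, h.t)) fun a b h => by
    simp only [Prod.mk.injEq] at h
    exact Heis.ext h.1 h.2

lemma comm_rel {p n : ℕ} [Fact p.Prime] (hp : p ≠ 2) (w : Vec p n) (h : Heis p n) :
    (⟨w, 0⟩ : Heis p n) * h = (⟨0, ω w h.v⟩ : Heis p n) * (h * ⟨w, 0⟩) := by
  have h2 := two_mul_ν hp
  have hs : ω h.v w = - ω w h.v := by
    simp only [ω, ← Finset.sum_neg_distrib]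
    exact Finset.sum_congr rfl fun i _ => by ring
  simp only [Heis.mul_def, Heis.mk.injEq, hs, ω_zero_left]
  refine ⟨by abel, ?_⟩
  linear_combination (ω w h.v) * h2

section
variable {p n : ℕ} [Fact p.Prime] {V : Type*} [AddCommGroup V] [Module ℂ V]
  (π : Representation ℂ (Heis p n) V)

lemma trace_zero (hp : p ≠ 2) (ψ : ZMod p → ℂ)
    (hψ : ∀ s : ZMod p, π ⟨0, s⟩ = ψ s • (1 : Module.End ℂ V))
    (hψnt : ∃ s, ψ s ≠ 1) (h : Heis p n) (hv : h.v ≠ 0) :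
    LinearMap.trace ℂ V (π h) = 0 := by
  obtain ⟨s, hs⟩ := hψnt
  obtain ⟨w, hw⟩ := exists_ω_eq h.v hv s
  have h1 := congrArg π (comm_rel hp w h)
  rw [map_mul, map_mul, map_mul, hw, hψ] at h1
  have h3 : π ⟨w, 0⟩ * π (⟨w, 0⟩⁻¹) = 1 := by rw [← map_mul, mul_inv_cancel, map_one]
  have h4 := congrArg (fun X => LinearMap.trace ℂ V (X * π (⟨w, 0⟩⁻¹))) h1
  simp only [smul_mul_assoc, one_mul, map_smul] at h4
  rw [LinearMap.trace_mul_comm, ← mul_assoc, mul_assoc (π h), h3, ← map_mul,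
    inv_mul_cancel, map_one, one_mul, mul_one, smul_eq_mul] at h4
  have h5 : (ψ s - 1) * LinearMap.trace ℂ V (π h) = 0 := by linear_combination -h4
  exact (mul_eq_zero.mp h5).resolve_left (sub_ne_zero.mpr hs)

lemma schur_scalar [FiniteDimensional ℂ V] (hπ : IsIrreducibleRep π) (S : Module.End ℂ V)
    (hS : ∀ h, S * π h = π h * S) : ∃ c : ℂ, S = c • (1 : Module.End ℂ V) := by
  obtain ⟨⟨x, hx⟩, hirr⟩ := hπ
  haveI : Nontrivial V := ⟨x, 0, hx⟩
  obtain ⟨c, hc⟩ := Module.End.exists_eigenvalue S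
  refine ⟨c, ?_⟩
  rcases hirr (Module.End.eigenspace S c) (fun g y hy => by
    rw [Module.End.mem_eigenspace_iff] at hy ⊢
    have := LinearMap.congr_fun (hS g) y
    simp only [Module.End.mul_apply] at this
    rw [this, hy, map_smul]) with h | h
  · exact absurd h hc
  · ext y
    have : y ∈ Module.End.eigenspace S c := h ▸ Submodule.mem_top
    rw [Module.End.mem_eigenspace_iff] at this
    simpa using this

lemma exists_intertwiner [FiniteDimensional ℂ V] (hp : p ≠ 2) (hπ : IsIrreducibleRep π)
    (ψ : ZMod p → ℂ)
    (hψ : ∀ s : ZMod p, π ⟨0, s⟩ = ψ s • (1 : Module.End ℂ V))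
    (hψnt : ∃ s, ψ s ≠ 1) (g : Sp p n) :
    ∃ T : Module.End ℂ V, T ≠ 0 ∧ ∀ h, T * π h = π (act g h) * T := by
  classical
  haveI : Fintype (Heis p n) := Fintype.ofFinite _
  let T : Module.End ℂ V → Module.End ℂ V := fun A => ∑ h, π (act g h) * A * π h⁻¹
  have hT : ∀ A k, T A * π k = π (act g k) * T A := by
    intro A k
    simp only [T, Finset.sum_mul, Finset.mul_sum]
    rw [← Equiv.sum_comp (Equiv.mulLeft k)]
    refine Finset.sum_congr rfl fun h _ => ?_
    simp only [Equiv.coe_mulLeft, map_mul, mul_inv_rev, mul_assoc]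
    rw [← map_mul π k⁻¹ k, inv_mul_cancel, map_one, mul_one]
  by_contra hcon
  push Not at hcon
  have hT0 : ∀ A, T A = 0 := by
    intro A
    by_contra hA
    obtain ⟨h, hh⟩ := hcon (T A) hA
    exact hh (hT A h)
  let b := Module.finBasis ℂ V
  have key : ∑ h, LinearMap.trace ℂ V (π (act g h)) * LinearMap.trace ℂ V (π h⁻¹) = 0 := by
    simp only [LinearMap.trace_eq_matrix_trace ℂ b, Matrix.trace, Matrix.diag,
      LinearMap.toMatrix_apply, Finset.sum_mul_sum]
    rw [Finset.sum_comm]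
    refine Finset.sum_eq_zero fun i _ => ?_
    rw [Finset.sum_comm]
    refine Finset.sum_eq_zero fun j _ => ?_
    have h1 := hT0 ((b.coord j).smulRight (b i))
    have h2 := congrArg (fun X : Module.End ℂ V => b.coord i (X (b j))) h1
    simp only [T, LinearMap.sum_apply, map_sum, Module.End.mul_apply,
      LinearMap.smulRight_apply, map_smul, LinearMap.zero_apply, map_zero, smul_eq_mul,
      Module.Basis.coord_apply] at h2
    rw [← h2]
    exact Finset.sum_congr rfl fun h _ => mul_comm _ _
  obtain ⟨⟨x, hx⟩, -⟩ := hπ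
  haveI : Nontrivial V := ⟨x, 0, hx⟩
  have hd : (0 : ℕ) < Module.finrank ℂ V := Module.finrank_pos
  have hterm : ∀ h : Heis p n,
      LinearMap.trace ℂ V (π (act g h)) * LinearMap.trace ℂ V (π h⁻¹) =
        (((if h.v = 0 then Module.finrank ℂ V ^ 2 else 0 : ℕ)) : ℂ) := by
    intro h
    split_ifs with hv
    · have e1 : act g h = h := by
        apply Heis.ext
        · simp [act, hv]
        · simp [act]
      have e2 : h = ⟨0, h.t⟩ := Heis.ext hv rfl
      have e3 : h⁻¹ = ⟨0, -h.t⟩ := by rw [Heis.inv_def, hv, neg_zero]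
      have e4 : π h * π h⁻¹ = 1 := by rw [← map_mul, mul_inv_cancel, map_one]
      rw [e1]
      have a1 : π h = ψ h.t • (1 : Module.End ℂ V) := by
        conv_lhs => rw [e2]
        exact hψ _
      have a2 : π h⁻¹ = ψ (-h.t) • (1 : Module.End ℂ V) := by rw [e3]; exact hψ _
      rw [a1, a2] at e4 ⊢
      have e5 := congrArg (LinearMap.trace ℂ V) e4
      simp only [smul_mul_smul_comm, mul_one, map_smul, LinearMap.trace_one, smul_eq_mul]
        at e5 ⊢
      push_cast
      linear_combination (Module.finrank ℂ V : ℂ) * e5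
    · rw [trace_zero π hp ψ hψ hψnt h⁻¹ (by simpa [Heis.inv_def] using hv)]
      simp
  rw [Finset.sum_congr rfl fun h _ => hterm h, ← Nat.cast_sum, Nat.cast_eq_zero,
    Finset.sum_eq_zero_iff] at key
  have := key 1 (Finset.mem_univ _)
  rw [if_pos (show (1 : Heis p n).v = 0 from rfl)] at this
  exact absurd this (by positivity)

lemma exists_unit_intertwiner [FiniteDimensional ℂ V] (hp : p ≠ 2) (hπ : IsIrreducibleRep π)
    (ψ : ZMod p → ℂ)
    (hψ : ∀ s : ZMod p, π ⟨0, s⟩ = ψ s • (1 : Module.End ℂ V))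
    (hψnt : ∃ s, ψ s ≠ 1) (g : Sp p n) :
    ∃ T : (Module.End ℂ V)ˣ, ∀ h, (T : Module.End ℂ V) * π h = π (act g h) * T := by
  obtain ⟨T, hT0, hT⟩ := exists_intertwiner π hp hπ ψ hψ hψnt g
  have hker : LinearMap.ker T = ⊥ := by
    rcases hπ.2 (LinearMap.ker T) (fun k y hy => by
      rw [LinearMap.mem_ker] at hy ⊢
      have := LinearMap.congr_fun (hT k) y
      simp only [Module.End.mul_apply] at this
      rw [this, hy, map_zero]) with h | h
    · exact h
    · exact absurd (LinearMap.ker_eq_top.mp h) hT0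
  have hu : IsUnit T := (LinearMap.isUnit_iff_ker_eq_bot T).mpr hker
  obtain ⟨U, rfl⟩ := hu
  exact ⟨U, hT⟩

end

end RK

namespace RK

/-- existence of a projective representation of `Sp(2n, F_p)` satisfying the
Egorov identity. -/
theorem exists_projective_representation {p n : ℕ} [Fact p.Prime] (hp : p ≠ 2) (hn : 0 < n)
    {V : Type*} [AddCommGroup V] [Module ℂ V] [FiniteDimensional ℂ V]
    (π : Representation ℂ (Heis p n) V) (hπ : IsIrreducibleRep π)
    (ψ : ZMod p → ℂ) (hψ : ∀ s : ZMod p, π ⟨0, s⟩ = ψ s • (1 : Module.End ℂ V))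
    (hψnt : ∃ s, ψ s ≠ 1) :
    ∃ ρ : Sp p n → (Module.End ℂ V)ˣ, Egorov π ρ ∧
      ∀ g₁ g₂ : Sp p n, ∃ c : ℂˣ,
        (ρ (g₁ * g₂) : Module.End ℂ V) =
          (c : ℂ) • ((ρ g₁ : Module.End ℂ V) * (ρ g₂ : Module.End ℂ V)) := by
  choose ρ hρ using exists_unit_intertwiner π hp hπ ψ hψ hψnt
  refine ⟨ρ, ?_, ?_⟩
  · intro g v t
    rw [hρ g ⟨v, t⟩, mul_assoc, Units.mul_inv, mul_one]
    rfl
  · intro g₁ g₂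
    have h12 : ∀ h, ((ρ g₁ * ρ g₂ : (Module.End ℂ V)ˣ) : Module.End ℂ V) * π h =
        π (act (g₁ * g₂) h) * ((ρ g₁ * ρ g₂ : (Module.End ℂ V)ˣ) : Module.End ℂ V) := by
      intro h
      rw [Units.val_mul, mul_assoc, hρ g₂, ← mul_assoc, hρ g₁, mul_assoc, act_mul]
    set U := ρ g₁ * ρ g₂ with hU
    have hS : ∀ h, ((U⁻¹ * ρ (g₁ * g₂) : (Module.End ℂ V)ˣ) : Module.End ℂ V) * π h =
        π h * ((U⁻¹ * ρ (g₁ * g₂) : (Module.End ℂ V)ˣ) : Module.End ℂ V) := by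
      intro h
      have h3 : ((U⁻¹ : (Module.End ℂ V)ˣ) : Module.End ℂ V) * π (act (g₁ * g₂) h) =
          π h * ((U⁻¹ : (Module.End ℂ V)ˣ) : Module.End ℂ V) := by
        rw [Units.inv_mul_eq_iff_eq_mul, ← mul_assoc, h12, mul_assoc, Units.mul_inv, mul_one]
      rw [Units.val_mul, mul_assoc, hρ, ← mul_assoc, h3, mul_assoc]
    obtain ⟨c, hc⟩ := schur_scalar π hπ _ hS
    have hc0 : c ≠ 0 := by
      rintro rfl
      obtain ⟨⟨x, hx⟩, -⟩ := hπ
      haveI : Nontrivial V := ⟨x, 0, hx⟩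
      rw [zero_smul] at hc
      exact Units.ne_zero _ hc
    refine ⟨Units.mk0 c hc0, ?_⟩
    rw [Units.val_mul, Units.inv_mul_eq_iff_eq_mul, mul_smul_comm, mul_one] at hc
    rw [hc, hU, Units.val_mul, Units.val_mk0]

end RK
end
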